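/- arXiv:2310.12026 — 3 statements merged into one kernel-verified Lean document; each statement's English description precedes it below -/
import Mathlib

section
/- Let f : {0,1} → ℝ and let p ∈ [0,1]. Then ∫₀¹ (f(𝟙[u > 1 − p]) − f(𝟙[u < p])) · (u − 1/2) du = p·(1 − p)·(f(1) − f(0)), where 𝟙[·] denotes the indicator (1 if the condition holds, 0 otherwise) and the integral is with respect to Lebesgue measure on [0,1]. -/
open MeasureTheory Real

/-- The integral of `u - 1 / 2` over a half-open interval. -/
theorem setIntegral_Ioc_sub_half {a b : ℝ} (hab : a ≤ b) :
    ∫ u in Set.Ioc a b, (u - 1 / 2) = (b - a) * (a + b - 1) / 2 := by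
  rw [← intervalIntegral.integral_of_le hab,
    intervalIntegral.integral_sub (by simp) (by simp), integral_id,
    intervalIntegral.integral_const, smul_eq_mul]
  ring

/-- For `f : {0,1} → ℝ` (encoded as `f : Bool → ℝ`) and `p ∈ [0,1]`,
`∫₀¹ (f(𝟙[u > 1 − p]) − f(𝟙[u < p])) · (u − 1/2) du = p·(1 − p)·(f(1) − f(0))`. -/
theorem stmt_1 (f : Bool → ℝ) (p : ℝ) (hp : p ∈ Set.Icc (0 : ℝ) 1) :
    (∫ u in Set.Icc (0 : ℝ) 1,
        (f (decide (u > 1 - p)) - f (decide (u < p))) * (u - 1 / 2)) =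
      p * (1 - p) * (f true - f false) := by
  obtain ⟨hp0, hp1⟩ := hp
  have hint : IntegrableOn (fun u : ℝ => u - 1 / 2) (Set.Icc 0 1) :=
    (by fun_prop : Continuous fun u : ℝ => u - 1 / 2).integrableOn_Icc
  have hfun : (fun u : ℝ => (f (decide (u > 1 - p)) - f (decide (u < p))) * (u - 1 / 2)) =
      fun u => (f true - f false) *
        ((Set.Ioi (1 - p)).indicator (fun u => u - 1 / 2) u -
          (Set.Iio p).indicator (fun u => u - 1 / 2) u) := by
    funext u
    by_cases h₁ : 1 - p < u <;> by_cases h₂ : u < p <;>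
      simp [Set.indicator, h₁, h₂] <;> ring
  have hupper : Set.Icc (0 : ℝ) 1 ∩ Set.Ioi (1 - p) = Set.Ioc (1 - p) 1 := by
    ext u
    simp only [Set.mem_inter_iff, Set.mem_Icc, Set.mem_Ioi, Set.mem_Ioc]
    grind
  have hlower : Set.Icc (0 : ℝ) 1 ∩ Set.Iio p = Set.Ico 0 p := by
    ext u
    simp only [Set.mem_inter_iff, Set.mem_Icc, Set.mem_Iio, Set.mem_Ico]
    grind
  rw [hfun, integral_const_mul,
    integral_sub (hint.indicator measurableSet_Ioi) (hint.indicator measurableSet_Iio),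
    setIntegral_indicator measurableSet_Ioi, setIntegral_indicator measurableSet_Iio,
    hupper, hlower, integral_Ico_eq_integral_Ioo, ← integral_Ioc_eq_integral_Ioo,
    setIntegral_Ioc_sub_half (by linarith), setIntegral_Ioc_sub_half hp0]
  ring
end

section
/- Let a, b, c be real numbers and set p₁ = e^a/(e^a + e^c) and p₂ = e^b/(e^b + e^c). Then p₁·(1 − p₂) / (p₁·(1 − p₂) + (1 − p₁)·p₂) = e^a/(e^a + e^b), and (1 − p₁)·p₂ / (p₁·(1 − p₂) + (1 − p₁)·p₂) = e^b/(e^a + e^b). -/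
open Real

/-- core of Lemma 2 of the paper: with
`p₁ = e^a/(e^a + e^c)` and `p₂ = e^b/(e^b + e^c)`, we have
`p₁(1 − p₂)/(p₁(1 − p₂) + (1 − p₁)p₂) = e^a/(e^a + e^b)` and
`(1 − p₁)p₂/(p₁(1 − p₂) + (1 − p₁)p₂) = e^b/(e^a + e^b)`. -/
theorem stmt_6 (a b c : ℝ) (p₁ p₂ : ℝ)
    (h₁ : p₁ = Real.exp a / (Real.exp a + Real.exp c))
    (h₂ : p₂ = Real.exp b / (Real.exp b + Real.exp c)) :
    p₁ * (1 - p₂) / (p₁ * (1 - p₂) + (1 - p₁) * p₂) =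
        Real.exp a / (Real.exp a + Real.exp b) ∧
      (1 - p₁) * p₂ / (p₁ * (1 - p₂) + (1 - p₁) * p₂) =
        Real.exp b / (Real.exp a + Real.exp b) := by
  have hx := Real.exp_pos a
  have hy := Real.exp_pos b
  have hz := Real.exp_pos c
  set x := Real.exp a
  set y := Real.exp b
  set z := Real.exp c
  have hxz : x + z ≠ 0 := by positivity
  have hyz : y + z ≠ 0 := by positivity
  have hk : z / ((x + z) * (y + z)) ≠ 0 := by positivity
  have e₁ : p₁ * (1 - p₂) = z / ((x + z) * (y + z)) * x := by
    rw [h₁, h₂]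
    field_simp
    ring
  have e₂ : (1 - p₁) * p₂ = z / ((x + z) * (y + z)) * y := by
    rw [h₁, h₂]
    field_simp
    ring
  rw [e₁, e₂, ← mul_add]
  exact ⟨mul_div_mul_left _ _ hk, mul_div_mul_left _ _ hk⟩
end

section
/- Let a, b, c be real numbers and set p₁ = e^a/(e^a + e^c) and p₂ = e^b/(e^b + e^c). Then p₁ − p₂ = (p₁·(1 − p₂) + (1 − p₁)·p₂) · (e^a − e^b)/(e^a + e^b). -/
open Real

/-- identity underlying Lemma 3 of the paper: with
`p₁ = e^a/(e^a + e^c)` and `p₂ = e^b/(e^b + e^c)`, we have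
`p₁ − p₂ = (p₁(1 − p₂) + (1 − p₁)p₂) · (e^a − e^b)/(e^a + e^b)`. -/
theorem stmt_7 (a b c : ℝ) (p₁ p₂ : ℝ)
    (h₁ : p₁ = Real.exp a / (Real.exp a + Real.exp c))
    (h₂ : p₂ = Real.exp b / (Real.exp b + Real.exp c)) :
    p₁ - p₂ =
      (p₁ * (1 - p₂) + (1 - p₁) * p₂) *
        ((Real.exp a - Real.exp b) / (Real.exp a + Real.exp b)) := by
  have hac : exp a + exp c ≠ 0 := by positivity
  have hbc : exp b + exp c ≠ 0 := by positivity
  have hab : exp a + exp b ≠ 0 := by positivity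
  subst h₁ h₂
  field_simp
  ring
end
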